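/- arXiv:2504.01497 — 2 statements merged into one kernel-verified Lean document; each statement's English description precedes it below -/
import Mathlib

section
/- Let (x_k), (v_k) be generated by the symplectic Euler scheme, and suppose conditions (1), (2), (3) on (s, Δ₁, Δ₂) hold. Then the Lyapunov function E is nonincreasing, E(k+1) ≤ E(k) for all k ≥ 0, and consequently f(x_k) − f(x*) − (Δ₂√s/2)‖∇f(x_k)‖² ≤ (1/(1+Δ₁))·(1 + √(μs)/(1+√(μs)))^{−k}·E(0) for all k ≥ 0. -/
open scoped RealInnerProductSpace

section SmoothConvex

variable {H : Type*} [NormedAddCommGroup H] [InnerProductSpace ℝ H] [CompleteSpace H]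
  {f : H → ℝ} {μ L : ℝ}

theorem hasDerivAt_comp_add_smul_gradient (hf : Differentiable ℝ f) (x d : H) (t : ℝ) :
    HasDerivAt (fun t : ℝ => f (x + t • d)) ⟪gradient f (x + t • d), d⟫ t := by
  have hline : HasDerivAt (fun t : ℝ => x + t • d) d t := by
    simpa using ((hasDerivAt_id t).smul_const d).const_add x
  rw [inner_gradient_left]
  exact (hf (x + t • d)).hasFDerivAt.comp_hasDerivAt t hline

theorem StrongConvexOn.add_inner_gradient_add_le (hsc : StrongConvexOn Set.univ μ f)
    (hf : Differentiable ℝ f) (x y : H) :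
    f x + ⟪gradient f x, y - x⟫ + μ / 2 * ‖y - x‖ ^ 2 ≤ f y := by
  set d := y - x with hd
  have hconv : ConvexOn ℝ Set.univ
      (fun t : ℝ => f (x + t • d) - μ / 2 * ‖x + t • d‖ ^ 2) := by
    have h := (strongConvexOn_iff_convex.1 hsc).comp_affineMap (AffineMap.lineMap x y)
    refine h.congr fun t _ => ?_
    simp [AffineMap.lineMap_apply, ← hd, add_comm]
  have hline : HasDerivAt (fun t : ℝ => x + t • d) d 0 := by
    simpa using ((hasDerivAt_id (0 : ℝ)).smul_const d).const_add x
  have hder := (hasDerivAt_comp_add_smul_gradient hf x d 0).sub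
    (hline.norm_sq.const_mul (μ / 2))
  have hslope := hconv.le_slope_of_hasDerivAt (Set.mem_univ 0) (Set.mem_univ 1) one_pos hder
  have hy : x + d = y := by simp [hd]
  have hnorm := norm_add_sq_real x d
  simp only [slope_def_field, zero_smul, one_smul, add_zero, sub_zero, div_one] at hslope
  rw [hnorm, hy] at hslope
  linarith

/-- The descent lemma. -/
theorem le_add_inner_gradient_add_of_lipschitz (hf : Differentiable ℝ f)
    (hL : ∀ x y, ‖gradient f x - gradient f y‖ ≤ L * ‖x - y‖) (x y : H) :
    f y ≤ f x + ⟪gradient f x, y - x⟫ + L / 2 * ‖y - x‖ ^ 2 := by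
  set d := y - x with hd
  have hder (t : ℝ) : HasDerivAt
      (fun t : ℝ => f (x + t • d) - t * ⟪gradient f x, d⟫ - t ^ 2 * (L / 2 * ‖d‖ ^ 2))
      (⟪gradient f (x + t • d), d⟫ - 1 * ⟪gradient f x, d⟫
        - (2 * t) * (L / 2 * ‖d‖ ^ 2)) t := by
    refine ((hasDerivAt_comp_add_smul_gradient hf x d t).sub
      ((hasDerivAt_id t).mul_const _)).sub (HasDerivAt.mul_const ?_ _)
    simpa using hasDerivAt_pow 2 t
  have hanti := antitoneOn_of_deriv_nonpos (convex_Ici (0 : ℝ))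
    (fun t _ => (hder t).continuousAt.continuousWithinAt)
    (fun t _ => (hder t).differentiableAt.differentiableWithinAt) fun t ht => by
      rw [(hder t).deriv]
      rw [interior_Ici, Set.mem_Ioi] at ht
      have hcs := real_inner_le_norm (gradient f (x + t • d) - gradient f x) d
      have hlip := hL (x + t • d) x
      rw [add_sub_cancel_left, norm_smul, Real.norm_of_nonneg ht.le] at hlip
      rw [inner_sub_left] at hcs
      nlinarith [mul_le_mul_of_nonneg_right hlip (norm_nonneg d)]
  have h01 := hanti (Set.mem_Ici.2 le_rfl) (Set.mem_Ici.2 zero_le_one) zero_le_one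
  have hy : x + d = y := by simp [hd]
  simp only [zero_smul, one_smul, add_zero, hy] at h01
  linarith

theorem add_inner_gradient_add_norm_sq_le_of_lipschitz (hf : Differentiable ℝ f)
    (hL : ∀ x y, ‖gradient f x - gradient f y‖ ≤ L * ‖x - y‖) (hLpos : 0 < L)
    (hconv : ∀ x y, f x + ⟪gradient f x, y - x⟫ ≤ f y) (x y : H) :
    f x + ⟪gradient f x, y - x⟫ + 1 / (2 * L) * ‖gradient f y - gradient f x‖ ^ 2 ≤ f y := by
  set e := gradient f y - gradient f x with he
  have hlow := hconv x (y - L⁻¹ • e)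
  have hup := le_add_inner_gradient_add_of_lipschitz hf hL y (y - L⁻¹ • e)
  have hz : y - L⁻¹ • e - y = -(L⁻¹ • e) := by abel
  have hx : y - L⁻¹ • e - x = (y - x) - L⁻¹ • e := by abel
  have hsq : ⟪gradient f y, e⟫ - ⟪gradient f x, e⟫ = ‖e‖ ^ 2 := by
    rw [← inner_sub_left, ← he, real_inner_self_eq_norm_sq]
  rw [hz, norm_neg, norm_smul, Real.norm_of_nonneg (inv_nonneg.2 hLpos.le), inner_neg_right,
    inner_smul_right] at hup
  rw [hx, inner_sub_right, inner_smul_right] at hlow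
  have hcoef : L / 2 * (L⁻¹ * ‖e‖) ^ 2 = L⁻¹ / 2 * ‖e‖ ^ 2 := by field_simp
  have hcoef' : 1 / (2 * L) * ‖e‖ ^ 2 = L⁻¹ / 2 * ‖e‖ ^ 2 := by field_simp
  rw [hcoef] at hup
  rw [hcoef']
  linear_combination hlow + hup - L⁻¹ * hsq

theorem StrongConvexOn.modulus_le_of_lipschitz_gradient [Nontrivial H]
    (hsc : StrongConvexOn Set.univ μ f) (hf : Differentiable ℝ f)
    (hL : ∀ x y, ‖gradient f x - gradient f y‖ ≤ L * ‖x - y‖) : μ ≤ L := by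
  obtain ⟨d, hd⟩ := exists_ne (0 : H)
  have hlow := hsc.add_inner_gradient_add_le hf 0 d
  have hup := le_add_inner_gradient_add_of_lipschitz hf hL 0 d
  rw [sub_zero] at hlow hup
  have hpos : 0 < ‖d‖ ^ 2 := by positivity
  nlinarith

end SmoothConvex

/-- One step of the energy estimate, where `y = x' - x*`, `ℓ = 1 / L`, `q = m h / (1 + m h)`, and
`F`, `F'` are the suboptimality gaps before and after the step. -/
theorem symplectic_euler_energy_step {H : Type*} [NormedAddCommGroup H] [InnerProductSpace ℝ H]
    {y v g g₀ : H} {F F' m h q ℓ Δ₁ Δ₂ : ℝ} (hm : 0 ≤ m) (hh : 0 ≤ h) (hq : 0 ≤ q)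
    (hqm : q * (1 + m * h) = m * h) (hΔ₁ : 0 ≤ Δ₁)
    (hdesc : F' - h * ⟪g, (1 + 2 * (m * h)) • v + ((1 + Δ₁) * h) • g + Δ₂ • (g - g₀)⟫
      + ℓ / 2 * ‖g₀ - g‖ ^ 2 ≤ F)
    (hstrong : F' ≤ ⟪g, y⟫ - m ^ 2 / 2 * ‖y‖ ^ 2)
    (hsmooth : F' ≤ ⟪g, y⟫ - ℓ / 2 * ‖g‖ ^ 2)
    (hcoc : ℓ * ‖g‖ ^ 2 ≤ ⟪g, y⟫)
    (h1 : Δ₂ * h ≤ ℓ) (h2 : Δ₂ ≤ h * (1 + Δ₁))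
    (h3 : q * Δ₂ ^ 2 - Δ₂ * h * (1 + Δ₁) * (q + 2) + (1 + Δ₁) ^ 2 * h ^ 2 - q * (Δ₁ * ℓ)
      + 2 * q * m * ℓ * (Δ₂ - h * (1 + Δ₁)) ≤ 0) :
    (1 + q) * ((1 + Δ₁) * (F' - Δ₂ * h / 2 * ‖g‖ ^ 2)
        + (1 / 2) * ‖v + m • (y + h • v) + Δ₂ • g‖ ^ 2) ≤
      (1 + Δ₁) * (F - Δ₂ * h / 2 * ‖g₀‖ ^ 2)
        + (1 / 2) * ‖((1 + 2 * (m * h)) • v + ((1 + Δ₁) * h) • g + Δ₂ • (g - g₀))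
          + m • y + Δ₂ • g₀‖ ^ 2 := by
  have hA : 0 ≤ 1 + Δ₁ := by linarith
  have hdesc := mul_le_mul_of_nonneg_left hdesc hA
  have hstrong := mul_le_mul_of_nonneg_left hstrong hq
  have hsmooth := mul_le_mul_of_nonneg_left hsmooth (mul_nonneg hq hΔ₁)
  have hcoc := mul_le_mul_of_nonneg_left hcoc
    (mul_nonneg (mul_nonneg hq hm) (sub_nonneg.2 h2))
  have h3 := mul_le_mul_of_nonneg_right h3 (sq_nonneg ‖g‖)
  have hdiff := mul_nonneg (mul_nonneg hA (sub_nonneg.2 h1)) (sq_nonneg ‖g₀ - g‖)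
  have hvel : 0 ≤ (m * h * (1 + m * h) + (m * h) ^ 2) * ‖v‖ ^ 2 := by positivity
  simp only [← real_inner_self_eq_norm_sq, inner_add_left, inner_add_right, inner_sub_left,
    inner_sub_right, real_inner_smul_left, real_inner_smul_right] at *
  rw [real_inner_comm g₀ g, real_inner_comm v g, real_inner_comm y g, real_inner_comm v y,
    real_inner_comm v g₀, real_inner_comm y g₀] at *
  linear_combination hdesc + hstrong + hsmooth + hcoc + h3 / 2 + hdiff / 2 + hvel / 2
    + hqm * ((1 + m * h) / 2 * ⟪v, v⟫ + m * ⟪v, y⟫ + Δ₂ * ⟪v, g⟫ + (1 + Δ₁) * ⟪y, g⟫)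


/-- for the symplectic Euler scheme under conditions (1)–(3), the Lyapunov
function is nonincreasing and the shifted function values converge at the stated rate. -/
theorem symplectic_euler_lyapunov_and_rate
    {H : Type*} [NormedAddCommGroup H] [InnerProductSpace ℝ H] [CompleteSpace H]
    (f : H → ℝ) (μ L : ℝ) (hμ : 0 < μ)
    (hf : ContDiff ℝ 1 f) (hsc : StrongConvexOn Set.univ μ f)
    (hL : ∀ x y, ‖gradient f x - gradient f y‖ ≤ L * ‖x - y‖)
    (xs : H) (hmin : ∀ y, f xs ≤ f y)
    (s : ℝ) (hs : 0 < s)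
    (Δ₁ Δ₂ : ℝ) (hΔ₁ : 0 ≤ Δ₁) (hΔ₂ : 0 ≤ Δ₂)
    (x v : ℕ → H)
    (hx : ∀ k, (Real.sqrt s)⁻¹ • (x (k + 1) - x k) = v k)
    (hv : ∀ k, (Real.sqrt s)⁻¹ • (v (k + 1) - v k) =
      -((2 * Real.sqrt μ) • v (k + 1)) - (1 + Δ₁) • gradient f (x (k + 1))
        - (Δ₂ / Real.sqrt s) • (gradient f (x (k + 1)) - gradient f (x k)))
    (E : ℕ → ℝ)
    (hE : ∀ k, E k = (1 + Real.sqrt (μ * s) / (1 + Real.sqrt (μ * s))) ^ k *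
      ((1 + Δ₁) * (f (x k) - f xs - Δ₂ * Real.sqrt s / 2 * ‖gradient f (x k)‖ ^ 2) +
        (1 / 2) * ‖v k + Real.sqrt μ • (x (k + 1) - xs) + Δ₂ • gradient f (x k)‖ ^ 2))
    (h1 : Δ₂ * Real.sqrt s ≤ 1 / L)
    (h2 : Δ₂ ≤ Real.sqrt s * (1 + Δ₁))
    (h3 : Real.sqrt (μ * s) / (1 + Real.sqrt (μ * s)) * Δ₂ ^ 2
      - Δ₂ * Real.sqrt s * (1 + Δ₁) * (Real.sqrt (μ * s) / (1 + Real.sqrt (μ * s)) + 2)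
      + (1 + Δ₁) ^ 2 * s
      - Real.sqrt (μ * s) / (1 + Real.sqrt (μ * s)) * (Δ₁ / L)
      + 2 * μ * Real.sqrt s / ((1 + Real.sqrt (μ * s)) * L)
          * (Δ₂ - Real.sqrt s * (1 + Δ₁)) ≤ 0) :
    (∀ k, E (k + 1) ≤ E k) ∧
    ∀ k, f (x k) - f xs - Δ₂ * Real.sqrt s / 2 * ‖gradient f (x k)‖ ^ 2 ≤
      1 / (1 + Δ₁) * ((1 + Real.sqrt (μ * s) / (1 + Real.sqrt (μ * s))) ^ k)⁻¹ * E 0 := by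
  have hdiff : Differentiable ℝ f := hf.differentiable one_ne_zero
  set q := Real.sqrt (μ * s) / (1 + Real.sqrt (μ * s)) with hqdef
  have hq : 0 ≤ q := by positivity
  have hA : 0 < 1 + Δ₁ := by linarith
  have hanti : ∀ k, E (k + 1) ≤ E k := by
    intro k
    rcases subsingleton_or_nontrivial H with hH | hH
    · have hzero (z : H) : z = 0 := Subsingleton.elim z 0
      simp [hE, hzero (x _), hzero xs, hzero (gradient f _), hzero (v _)]
    have hLpos : 0 < L := hμ.trans_le (hsc.modulus_le_of_lipschitz_gradient hdiff hL)
    have hstrong := hsc.add_inner_gradient_add_le hdiff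
    have hsmooth := add_inner_gradient_add_norm_sq_le_of_lipschitz hdiff hL hLpos fun a b =>
      (le_add_of_nonneg_right (by positivity)).trans (hstrong a b)
    have hgrad : gradient f xs = 0 := by
      have hloc : IsLocalMin f xs := Filter.Eventually.of_forall hmin
      simp [gradient, hloc.fderiv_eq_zero]
    have hms : Real.sqrt (μ * s) = Real.sqrt μ * Real.sqrt s := Real.sqrt_mul hμ.le s
    set m := Real.sqrt μ
    set h := Real.sqrt s
    have hm : 0 < m := Real.sqrt_pos.2 hμ
    have hh : 0 < h := Real.sqrt_pos.2 hs
    have hm2 : μ = m ^ 2 := (Real.sq_sqrt hμ.le).symm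
    have hh2 : s = h ^ 2 := (Real.sq_sqrt hs.le).symm
    have hqm : q * (1 + m * h) = m * h := by
      rw [hqdef, hms, div_mul_cancel₀ _ (by positivity)]
    have hxv (j : ℕ) : x (j + 1) - x j = h • v j := by
      rw [← hx j, smul_inv_smul₀ hh.ne']
    have hvk : v k = (1 + 2 * (m * h)) • v (k + 1) + ((1 + Δ₁) * h) • gradient f (x (k + 1))
        + Δ₂ • (gradient f (x (k + 1)) - gradient f (x k)) := by
      have hback : v k = v (k + 1) - h • h⁻¹ • (v (k + 1) - v k) := by
        rw [smul_inv_smul₀ hh.ne', sub_sub_cancel]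
      rw [hback, hv k]
      match_scalars <;> field_simp <;> ring
    have hnext : x (k + 1 + 1) - xs = (x (k + 1) - xs) + h • v (k + 1) := by
      rw [← hxv]; abel
    have hkey := symplectic_euler_energy_step (y := x (k + 1) - xs) (v := v (k + 1))
      (g := gradient f (x (k + 1))) (g₀ := gradient f (x k)) (F := f (x k) - f xs)
      (F' := f (x (k + 1)) - f xs) (ℓ := 1 / L) hm.le hh.le hq hqm hΔ₁ ?_ ?_ ?_ ?_ h1 h2 ?_
    · rw [hE, hE, pow_succ, mul_assoc, hnext, hvk]
      exact mul_le_mul_of_nonneg_left hkey (by positivity)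
    · have hle := hsmooth (x (k + 1)) (x k)
      rw [← hvk]
      rw [← neg_sub (x (k + 1)), hxv, inner_neg_right, real_inner_smul_right] at hle
      linear_combination hle
    · have hle := hstrong (x (k + 1)) xs
      rw [← neg_sub (x (k + 1)), inner_neg_right, norm_neg] at hle
      rw [← hm2]
      linear_combination hle
    · have hle := hsmooth (x (k + 1)) xs
      rw [← neg_sub (x (k + 1)), inner_neg_right, hgrad, zero_sub, norm_neg] at hle
      linear_combination hle
    · have hle := hsmooth (x (k + 1)) xs
      have hle' := hsmooth xs (x (k + 1))
      rw [← neg_sub (x (k + 1)), inner_neg_right, hgrad, zero_sub, norm_neg] at hle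
      rw [hgrad, sub_zero, inner_zero_left] at hle'
      linear_combination hle + hle'
    · have hcoef : 2 * μ * h / ((1 + Real.sqrt (μ * s)) * L) = 2 * q * m * (1 / L) := by
        rw [hqdef, hms, hm2]
        field_simp
      rw [hcoef] at h3
      rw [← hh2, mul_one_div Δ₁ L]
      exact h3
  refine ⟨hanti, fun k => ?_⟩
  have hle : E k ≤ E 0 := antitone_nat_of_succ_le hanti (Nat.zero_le k)
  have hr : 0 < (1 + q) ^ k := by positivity
  rw [hE k] at hle
  rw [mul_assoc, one_div, le_inv_mul_iff₀ hA, le_inv_mul_iff₀ hr]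
  exact (mul_le_mul_of_nonneg_left (le_add_of_nonneg_right (by positivity)) hr.le).trans hle
end

section
/- Consider the symplectic-Euler-derived algorithm with step size s = 1/L: x_{k+1} = x_k + (1/(1+2√(μ/L)))(x_k − x_{k−1}) − ((1+Δ₁)/((1+2√(μ/L))L))∇f(x_k) − (Δ₂/((1+2√(μ/L))√L))(∇f(x_k) − ∇f(x_{k−1})), with x₁ = x₀. If the perturbation parameters satisfy (1+Δ₁)/2 ≤ √L·Δ₂ < 1, then there exists a constant C ≥ 0 such that for all k ≥ 0, f(x_k) − f(x*) ≤ C·(1 + √(μ/L)/(1 + √(μ/L)))^{−k}; in particular f(x_k) − f(x*) ≤ C·(1 + (1/2)√(μ/L))^{−k}. -/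
open scoped RealInnerProductSpace

section FirstOrder

variable {H : Type*} [NormedAddCommGroup H] [InnerProductSpace ℝ H] [CompleteSpace H]

theorem DifferentiableAt.hasDerivAt_comp_lineMap {f : H → ℝ} {x y : H} {t : ℝ}
    (hf : DifferentiableAt ℝ f (AffineMap.lineMap x y t)) :
    HasDerivAt (fun t : ℝ => f (AffineMap.lineMap x y t))
      ⟪gradient f (AffineMap.lineMap x y t), y - x⟫ t := by
  have h := hf.hasGradientAt.hasFDerivAt.comp_hasDerivAt t
    (AffineMap.hasDerivAt_lineMap (a := x) (b := y) (x := t))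
  rwa [InnerProductSpace.toDual_apply_apply] at h

/-- The first-order characterization of strong convexity. -/
theorem StrongConvexOn.add_inner_gradient_le {f : H → ℝ} {m : ℝ}
    (hf : StrongConvexOn Set.univ m f) {x : H} (hd : DifferentiableAt ℝ f x) (y : H) :
    f x + ⟪gradient f x, y - x⟫ + m / 2 * ‖y - x‖ ^ 2 ≤ f y := by
  have hc := (strongConvexOn_iff_convex.1 hf).comp_affineMap (AffineMap.lineMap (k := ℝ) x y)
  have hd₀ : DifferentiableAt ℝ f (AffineMap.lineMap x y (0 : ℝ)) := by simpa using hd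
  have hnorm := (AffineMap.hasDerivAt_lineMap (𝕜 := ℝ) (a := x) (b := y) (x := 0)).norm_sq
  have hder := hd₀.hasDerivAt_comp_lineMap.sub (hnorm.const_mul (m / 2))
  have hs := hc.le_slope_of_hasDerivAt (x := 0) (y := 1) (by simp) (by simp) one_pos hder
  simp only [slope_def_field, Function.comp_apply, AffineMap.lineMap_apply_zero,
    AffineMap.lineMap_apply_one, sub_zero, div_one] at hs
  have hexp := norm_sub_sq_real y x
  rw [inner_sub_right x, real_inner_self_eq_norm_sq, real_inner_comm y x] at hs
  rw [hexp]
  linarith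

/-- The descent lemma. -/
theorem le_add_inner_gradient_of_gradient_lipschitz {f : H → ℝ} {L : ℝ}
    (hf : Differentiable ℝ f)
    (hL : ∀ x y, ‖gradient f x - gradient f y‖ ≤ L * ‖x - y‖) (x y : H) :
    f y ≤ f x + ⟪gradient f x, y - x⟫ + L / 2 * ‖y - x‖ ^ 2 := by
  have hder (t : ℝ) := ((hf _).hasDerivAt_comp_lineMap (x := x) (y := y) (t := t)).sub
    (((hasDerivAt_id t).mul_const ⟪gradient f x, y - x⟫).add
      (((hasDerivAt_id t).pow 2).mul_const (L / 2 * ‖y - x‖ ^ 2)))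
  have hanti := antitoneOn_of_deriv_nonpos (convex_Icc (0 : ℝ) 1)
    (fun t _ => (hder t).continuousAt.continuousWithinAt)
    (fun t _ => (hder t).differentiableAt.differentiableWithinAt) (fun t ht => by
      rw [(hder t).deriv]
      rw [interior_Icc] at ht
      have hlip := hL (AffineMap.lineMap x y t) x
      have hcs := real_inner_le_norm (gradient f (AffineMap.lineMap x y t) - gradient f x) (y - x)
      have hline : AffineMap.lineMap x y t - x = t • (y - x) := by
        simp [AffineMap.lineMap_apply]
      rw [hline, norm_smul, Real.norm_eq_abs, abs_of_pos ht.1] at hlip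
      rw [inner_sub_left] at hcs
      have := mul_le_mul_of_nonneg_right hlip (norm_nonneg (y - x))
      simp only [id_eq, Nat.cast_ofNat, Nat.add_one_sub_one, pow_one]
      nlinarith)
  have h := hanti (Set.left_mem_Icc.2 zero_le_one) (Set.right_mem_Icc.2 zero_le_one) zero_le_one
  simp only [Pi.sub_apply, Pi.add_apply, Pi.pow_apply, id_eq, AffineMap.lineMap_apply_zero,
    AffineMap.lineMap_apply_one] at h
  linarith

/-- The interpolation inequality for smooth convex functions. -/
theorem add_inner_gradient_add_le_of_gradient_lipschitz {f : H → ℝ} {m L : ℝ} (hm : 0 ≤ m)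
    (hLpos : 0 < L) (hf : Differentiable ℝ f) (hsc : StrongConvexOn Set.univ m f)
    (hL : ∀ x y, ‖gradient f x - gradient f y‖ ≤ L * ‖x - y‖) (x y : H) :
    f x + ⟪gradient f x, y - x⟫ + 1 / (2 * L) * ‖gradient f y - gradient f x‖ ^ 2 ≤ f y := by
  set δ := gradient f y - gradient f x with hδ
  have hlow := hsc.add_inner_gradient_le (hf x) (y - L⁻¹ • δ)
  have hup := le_add_inner_gradient_of_gradient_lipschitz hf hL y (y - L⁻¹ • δ)
  have hδδ : ⟪gradient f y, δ⟫ - ⟪gradient f x, δ⟫ = ‖δ‖ ^ 2 := by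
    rw [← inner_sub_left, real_inner_self_eq_norm_sq]
  have hpos : 0 ≤ m / 2 * ‖y - L⁻¹ • δ - x‖ ^ 2 := by positivity
  rw [show y - L⁻¹ • δ - x = (y - x) - L⁻¹ • δ by abel, inner_sub_right,
    inner_smul_right] at hlow
  rw [show y - L⁻¹ • δ - y = -(L⁻¹ • δ) by abel, inner_neg_right, inner_smul_right, norm_neg,
    norm_smul, Real.norm_eq_abs, abs_of_pos (inv_pos.2 hLpos)] at hup
  rw [show y - L⁻¹ • δ - x = (y - x) - L⁻¹ • δ by abel] at hpos
  have hquad : L / 2 * (L⁻¹ * ‖δ‖) ^ 2 = 1 / (2 * L) * ‖δ‖ ^ 2 := by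
    field_simp
  have hlin : L⁻¹ * ⟪gradient f y, δ⟫ - L⁻¹ * ⟪gradient f x, δ⟫ = 2 * (1 / (2 * L) * ‖δ‖ ^ 2) := by
    rw [← mul_sub, hδδ]
    field_simp
  linarith

end FirstOrder

section Energy

variable {H : Type*} [NormedAddCommGroup H] [InnerProductSpace ℝ H]

/-- The Lyapunov function of the scheme with step size `1`, as a function of the objective gap `D`,
the position `y` relative to the minimizer, the gradient `g` and the velocity `v`. -/
noncomputable def symplecticEnergy (q a d D : ℝ) (y g v : H) : ℝ :=
  (a - q * d / (1 + q)) * (1 + q) / (1 + 2 * q) * (D - d / 2 * ‖g‖ ^ 2)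
    + 1 / 2 * ‖v + q • (y + v) + d • g‖ ^ 2

/-- `w` stands for the shifted velocity `v + d • g`. -/
theorem symplecticEnergy_step_aux {q a d D₀ D : ℝ} {y w g g₀ : H} (hq : 0 < q) (ha : 1 ≤ a)
    (had : a ≤ 2 * d) (hd : d ≤ 1)
    (hsc : D + q ^ 2 / 2 * ‖y‖ ^ 2 ≤ ⟪y, g⟫)
    (hco : D - D₀ + 1 / 2 * ‖g - g₀‖ ^ 2 ≤
      ⟪(1 + 2 * q) • w + (a - 2 * q * d) • g - d • g₀, g⟫)
    (hD : 1 / 2 * ‖g‖ ^ 2 ≤ D) :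
    (1 + 2 * q) / (1 + q) * ((a - q * d / (1 + q)) * (1 + q) / (1 + 2 * q) * (D - d / 2 * ‖g‖ ^ 2)
      + 1 / 2 * ‖(1 + q) • w + q • y - (q * d) • g‖ ^ 2) ≤
    (a - q * d / (1 + q)) * (1 + q) / (1 + 2 * q) * (D₀ - d / 2 * ‖g₀‖ ^ 2)
      + 1 / 2 * ‖(1 + 2 * q) • w + (a - 2 * q * d) • g + q • y‖ ^ 2 := by
  set c := a - q * d / (1 + q) with hc
  have hcq : c * (1 + q) = a * (1 + q) - q * d := by rw [hc]; field_simp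
  have hc1 : 1 ≤ c * (1 + q) := by nlinarith
  have hc0 : 0 ≤ c := by
    by_contra! h
    nlinarith
  have ht : 0 ≤ ‖w + (c / (1 + 2 * q) - q * d / (1 + q)) • g‖ ^ 2 := by positivity
  have hs : 0 ≤ ‖g - g₀‖ ^ 2 := by positivity
  have e₁ := mul_nonneg (show 0 ≤ c * (1 + q) / (1 + 2 * q) by positivity) (sub_nonneg.2 hco)
  have e₂ := mul_nonneg (show 0 ≤ c * q by positivity) (sub_nonneg.2 hsc)
  have e₃ := mul_nonneg (show 0 ≤ c * (2 * q ^ 2) / (1 + 2 * q) by positivity) (sub_nonneg.2 hD)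
  have e₄ := mul_nonneg (show 0 ≤ c * (1 + q) / (1 + 2 * q) * ((1 - d) / 2) from
    mul_nonneg (by positivity) (by linarith)) hs
  have e₅ := mul_nonneg (show 0 ≤ q * (1 + 2 * q) / 2 by positivity) ht
  have e₆ := mul_nonneg (show 0 ≤ q ^ 3 / (2 * (1 + q)) * (c * (1 + q) - 1) from
    mul_nonneg (by positivity) (by linarith)) (sq_nonneg ‖y‖)
  have e₇ := mul_nonneg
    (show 0 ≤ c / (1 + 2 * q) * ((1 + q) * (d - a / 2) + q * d + q ^ 2) from
      mul_nonneg (by positivity) (by nlinarith)) (sq_nonneg ‖g‖)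
  refine le_of_sub_nonneg ((add_nonneg (add_nonneg (add_nonneg (add_nonneg (add_nonneg
    (add_nonneg e₁ e₂) e₃) e₄) e₅) e₆) e₇).trans_eq ?_)
  clear_value c
  obtain rfl : a = c + q * d / (1 + q) := by linarith
  simp only [← real_inner_self_eq_norm_sq, inner_add_left, inner_add_right, inner_sub_left,
    inner_sub_right, real_inner_smul_left, real_inner_smul_right]
  simp only [real_inner_comm w g, real_inner_comm w y, real_inner_comm g y, real_inner_comm g g₀]
  field_simp
  ring

theorem symplecticEnergy_step {q a d D₀ D : ℝ} {y₀ y v₀ v g₀ g : H} (hq : 0 < q) (ha : 1 ≤ a)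
    (had : a ≤ 2 * d) (hd : d ≤ 1)
    (hy : y = y₀ + v₀) (hv : (1 + 2 * q) • v = v₀ - a • g - d • (g - g₀))
    (hsc : D + q ^ 2 / 2 * ‖y‖ ^ 2 ≤ ⟪y, g⟫)
    (hco : D - D₀ + 1 / 2 * ‖g - g₀‖ ^ 2 ≤ ⟪v₀, g⟫)
    (hD : 1 / 2 * ‖g‖ ^ 2 ≤ D) :
    (1 + 2 * q) / (1 + q) * symplecticEnergy q a d D y g v ≤
      symplecticEnergy q a d D₀ y₀ g₀ v₀ := by
  have hv₀ : v₀ = (1 + 2 * q) • (v + d • g) + (a - 2 * q * d) • g - d • g₀ := by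
    rw [smul_add, hv]
    module
  rw [hv₀] at hco
  have h := symplecticEnergy_step_aux hq ha had hd hsc hco hD
  have e₁ : (1 + q) • (v + d • g) + q • y - (q * d) • g = v + q • (y + v) + d • g := by module
  have e₂ : (1 + 2 * q) • (v + d • g) + (a - 2 * q * d) • g + q • y =
      v₀ + q • (y₀ + v₀) + d • g₀ := by
    rw [← hy, hv₀]
    module
  rw [e₁, e₂] at h
  exact h

/-- The Lyapunov function controls the objective gap. -/
theorem mul_le_symplecticEnergy {q a d D : ℝ} (y g v : H) (hq : 0 ≤ q)
    (hd₀ : 0 ≤ d) (had : d ≤ a) (hD : 1 / 2 * ‖g‖ ^ 2 ≤ D) :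
    (a - q * d / (1 + q)) * (1 + q) / (1 + 2 * q) * (1 - d) * D ≤
      symplecticEnergy q a d D y g v := by
  have hc : 0 ≤ a - q * d / (1 + q) := by
    rw [sub_nonneg, div_le_iff₀ (by positivity)]
    nlinarith
  have hα : 0 ≤ (a - q * d / (1 + q)) * (1 + q) / (1 + 2 * q) := by positivity
  have hgap : (1 - d) * D ≤ D - d / 2 * ‖g‖ ^ 2 := by nlinarith
  have := mul_le_mul_of_nonneg_left hgap hα
  have hp : 0 ≤ 1 / 2 * ‖v + q • (y + v) + d • g‖ ^ 2 := by positivity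
  unfold symplecticEnergy
  rw [mul_assoc]
  linarith

end Energy

/-- Algorithm 1 (symplectic-Euler-derived scheme with step size `s = 1/L`)
achieves the accelerated rate when `(1+Δ₁)/2 ≤ √L·Δ₂ < 1`. -/
theorem symplectic_algorithm_accelerated_rate
    {H : Type*} [NormedAddCommGroup H] [InnerProductSpace ℝ H] [CompleteSpace H]
    (f : H → ℝ) (μ L : ℝ) (hμ : 0 < μ)
    (hf : ContDiff ℝ 1 f) (hsc : StrongConvexOn Set.univ μ f)
    (hL : ∀ x y, ‖gradient f x - gradient f y‖ ≤ L * ‖x - y‖)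
    (xs : H) (hmin : ∀ y, f xs ≤ f y)
    (Δ₁ Δ₂ : ℝ) (hΔ₁ : 0 ≤ Δ₁) (hΔ₂ : 0 ≤ Δ₂)
    (hpar₁ : (1 + Δ₁) / 2 ≤ Real.sqrt L * Δ₂) (hpar₂ : Real.sqrt L * Δ₂ < 1)
    (x : ℕ → H) (hinit : x 1 = x 0)
    (hrec : ∀ k, x (k + 2) = x (k + 1)
      + (1 / (1 + 2 * Real.sqrt (μ / L))) • (x (k + 1) - x k)
      - ((1 + Δ₁) / ((1 + 2 * Real.sqrt (μ / L)) * L)) • gradient f (x (k + 1))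
      - (Δ₂ / ((1 + 2 * Real.sqrt (μ / L)) * Real.sqrt L)) •
          (gradient f (x (k + 1)) - gradient f (x k))) :
    ∃ C, 0 ≤ C ∧ ∀ k,
      f (x k) - f xs ≤ C * ((1 + Real.sqrt (μ / L) / (1 + Real.sqrt (μ / L))) ^ k)⁻¹ ∧
      f (x k) - f xs ≤ C * ((1 + 1 / 2 * Real.sqrt (μ / L)) ^ k)⁻¹ := by
  have hLpos : 0 < L := by
    by_contra! h
    rw [Real.sqrt_eq_zero_of_nonpos h] at hpar₁
    linarith
  have hdiff : Differentiable ℝ f := hf.differentiable one_ne_zero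
  have hgxs : gradient f xs = 0 := by
    have hloc : IsLocalMin f xs := Filter.Eventually.of_forall hmin
    simp [gradient, hloc.fderiv_eq_zero]
  have hinterp := add_inner_gradient_add_le_of_gradient_lipschitz hμ.le hLpos hdiff hsc hL
  by_cases hconst : ∀ k, x k = xs
  · exact ⟨0, le_rfl, fun k => by simp [hconst]⟩
  obtain ⟨j, hj⟩ := not_forall.1 hconst
  have hμL : μ ≤ L := by
    have h₁ := hsc.add_inner_gradient_le (hdiff xs) (x j)
    have h₂ := le_add_inner_gradient_of_gradient_lipschitz hdiff hL xs (x j)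
    have h₃ : 0 < ‖x j - xs‖ ^ 2 := pow_pos (norm_pos_iff.2 (sub_ne_zero.2 hj)) 2
    have h₄ : μ / 2 * ‖x j - xs‖ ^ 2 ≤ L / 2 * ‖x j - xs‖ ^ 2 := by linarith
    linarith [le_of_mul_le_mul_right h₄ h₃]
  set q := Real.sqrt (μ / L) with hq_def
  have hq : 0 < q := Real.sqrt_pos.2 (by positivity)
  have hq1 : q ≤ 1 := Real.sqrt_le_one.2 ((div_le_one hLpos).2 hμL)
  have hqsq : q ^ 2 = μ / L := Real.sq_sqrt (by positivity)
  have hsqrt : Real.sqrt L ^ 2 = L := Real.sq_sqrt hLpos.le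
  have hsL : 0 < Real.sqrt L := Real.sqrt_pos.2 hLpos
  set d := Real.sqrt L * Δ₂ with hd_def
  set a := 1 + Δ₁ with ha_def
  have hd₀ : 0 ≤ d := by positivity
  have ha1 : 1 ≤ a := by linarith
  set D : ℕ → ℝ := fun k => (f (x k) - f xs) / L with hD_def
  set g : ℕ → H := fun k => L⁻¹ • gradient f (x k) with hg_def
  set E : ℕ → ℝ := fun k => symplecticEnergy q a d (D k) (x k - xs) (g k) (x (k + 1) - x k)
    with hE_def
  have hDg : ∀ k, 1 / 2 * ‖g k‖ ^ 2 ≤ D k := by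
    intro k
    have h := hinterp xs (x k)
    rw [hgxs, inner_zero_left, sub_zero] at h
    simp only [hD_def, hg_def, norm_smul, Real.norm_eq_abs, abs_of_pos (inv_pos.2 hLpos)]
    rw [le_div_iff₀ hLpos]
    calc 1 / 2 * (L⁻¹ * ‖gradient f (x k)‖) ^ 2 * L
        = 1 / (2 * L) * ‖gradient f (x k)‖ ^ 2 := by field_simp
      _ ≤ f (x k) - f xs := by linarith
  have hstep : ∀ k, (1 + 2 * q) / (1 + q) * E (k + 1) ≤ E k := by
    intro k
    refine symplecticEnergy_step hq ha1 (by linarith) hpar₂.le (by abel) ?_ ?_ ?_ (hDg _)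
    · have hv : x (k + 1 + 1) - x (k + 1) = (1 / (1 + 2 * q)) •
          ((x (k + 1) - x k) - a • g (k + 1) - d • (g (k + 1) - g k)) := by
        have hΔ : Δ₂ / ((1 + 2 * q) * Real.sqrt L) = 1 / (1 + 2 * q) * (d * L⁻¹) := by
          rw [hd_def, ← hsqrt]
          field_simp
          rw [Real.sqrt_sq hsL.le]
        have ha' : a / ((1 + 2 * q) * L) = 1 / (1 + 2 * q) * (a * L⁻¹) := by
          field_simp
        rw [hrec k, hΔ, ha']
        simp only [hg_def]
        module
      rw [hv, smul_smul, mul_one_div_cancel (by positivity), one_smul]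
    · have h := hsc.add_inner_gradient_le (hdiff (x (k + 1))) xs
      rw [← neg_sub (x (k + 1)) xs, inner_neg_right, norm_neg, real_inner_comm] at h
      simp only [hD_def, hg_def, real_inner_smul_right, hqsq]
      have h' : f (x (k + 1)) - f xs + μ / 2 * ‖x (k + 1) - xs‖ ^ 2 ≤
          ⟪x (k + 1) - xs, gradient f (x (k + 1))⟫ := by linarith
      have := mul_le_mul_of_nonneg_left h' (inv_pos.2 hLpos).le
      refine le_trans (le_of_eq ?_) this
      field_simp
    · have h := hinterp (x (k + 1)) (x k)
      rw [← neg_sub (x (k + 1)) (x k), inner_neg_right, real_inner_comm,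
        norm_sub_rev] at h
      simp only [hD_def, hg_def, real_inner_smul_right, ← smul_sub, norm_smul, Real.norm_eq_abs,
        abs_of_pos (inv_pos.2 hLpos)]
      have h' : f (x (k + 1)) - f (x k)
          + 1 / (2 * L) * ‖gradient f (x (k + 1)) - gradient f (x k)‖ ^ 2 ≤
          ⟪x (k + 1) - x k, gradient f (x (k + 1))⟫ := by linarith
      have := mul_le_mul_of_nonneg_left h' (inv_pos.2 hLpos).le
      refine le_trans (le_of_eq ?_) this
      field_simp
      ring
  have hrate : 1 + q / (1 + q) = (1 + 2 * q) / (1 + q) := by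
    field_simp
    ring
  have hdecay : ∀ k, E k ≤ E 0 * ((1 + q / (1 + q)) ^ k)⁻¹ := by
    intro k
    rw [hrate, ← div_eq_mul_inv, le_div_iff₀ (by positivity), mul_comm]
    induction k with
    | zero => simp
    | succ k ih =>
      rw [pow_succ, mul_assoc]
      exact (mul_le_mul_of_nonneg_left (hstep k) (by positivity)).trans ih
  set κ := (a - q * d / (1 + q)) * (1 + q) / (1 + 2 * q) * (1 - d) with hκ_def
  have hκ : 0 < κ := by
    have h₁ : 0 < a - q * d / (1 + q) := by
      rw [sub_pos, div_lt_iff₀ (by positivity)]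
      nlinarith
    have h₂ : 0 < 1 - d := by linarith
    positivity
  have hDE : ∀ k, κ * D k ≤ E k := fun k =>
    mul_le_symplecticEnergy _ _ _ hq.le hd₀ (by linarith) (hDg k)
  have hD0 : 0 ≤ D 0 := le_trans (by positivity) (hDg 0)
  have hE0 : 0 ≤ E 0 := le_trans (by positivity) (hDE 0)
  have hmain : ∀ k, f (x k) - f xs ≤ L / κ * E 0 * ((1 + q / (1 + q)) ^ k)⁻¹ := by
    intro k
    have h := (hDE k).trans (hdecay k)
    calc f (x k) - f xs = L / κ * (κ * D k) := by
          simp only [hD_def]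
          field_simp
      _ ≤ L / κ * (E 0 * ((1 + q / (1 + q)) ^ k)⁻¹) := by gcongr
      _ = L / κ * E 0 * ((1 + q / (1 + q)) ^ k)⁻¹ := by ring
  have hC : 0 ≤ L / κ * E 0 := by positivity
  refine ⟨L / κ * E 0, hC, fun k => ⟨hmain k, (hmain k).trans ?_⟩⟩
  have hle : 1 / 2 * q ≤ q / (1 + q) := by
    rw [le_div_iff₀ (by positivity)]
    nlinarith
  gcongr
end
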